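/- arXiv:1504.02731 — 2 statements merged into one kernel-verified Lean document; each statement's English description precedes it below -/
import Mathlib

section
/- For every σ > 0 and every h ∈ ℝ, | σ · E[sech⁴(h + σZ)] − (4/(3√(2π))) e^{−h²/(2σ²)} | ≤ Λ₁/σ², where Λ₁ = (π² − 6)/(18√(2π)). -/
open MeasureTheory Filter

/-- Standard Gaussian density. -/
noncomputable def stdGauss (z : ℝ) : ℝ := Real.exp (-z ^ 2 / 2) / Real.sqrt (2 * Real.pi)

/-- Gaussian expectation `E[f(h + σ Z)]` for a standard Gaussian `Z`. -/
noncomputable def gexp (f : ℝ → ℝ) (σ h : ℝ) : ℝ := ∫ z, f (h + σ * z) * stdGauss z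

/-- Hyperbolic secant. -/
noncomputable def sech (x : ℝ) : ℝ := 1 / Real.cosh x

lemma one_add_sq_div_two_le_cosh (x : ℝ) : 1 + x ^ 2 / 2 ≤ Real.cosh x := by
  have h1 : Real.cosh x = 1 + 2 * Real.sinh (x / 2) ^ 2 := by
    have := Real.cosh_two_mul (x / 2)
    rw [Real.cosh_sq, mul_div_cancel₀ x two_ne_zero] at this
    linarith
  have h2 : (x / 2) ^ 2 ≤ Real.sinh (x / 2) ^ 2 := by
    rcases le_total 0 (x / 2) with hx | hx
    · exact pow_le_pow_left₀ hx (Real.self_le_sinh_iff.2 hx) 2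
    · have := Real.sinh_le_self_iff.2 hx
      nlinarith
  rw [h1]
  linarith

lemma sech_pos (x : ℝ) : 0 < sech x := one_div_pos.2 (Real.cosh_pos x)

lemma sech_neg (x : ℝ) : sech (-x) = sech x := by simp [sech]

lemma sech_abs (x : ℝ) : sech |x| = sech x := by simp [sech]

lemma sech_le_one (x : ℝ) : sech x ≤ 1 :=
  (div_le_one (Real.cosh_pos x)).2 (Real.one_le_cosh x)

@[fun_prop]
lemma continuous_sech : Continuous sech :=
  continuous_const.div Real.continuous_cosh fun x => (Real.cosh_pos x).ne'

lemma one_add_sq_mul_sq_sech_le (x : ℝ) : (1 + x ^ 2) * sech x ^ 2 ≤ 1 := by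
  have hc := Real.cosh_pos x
  have h := one_add_sq_div_two_le_cosh x
  rw [sech, div_pow, one_pow, mul_one_div, div_le_one (by positivity)]
  nlinarith [sq_nonneg x, pow_le_pow_left₀ (by positivity) h 2, sq_nonneg (x ^ 2)]

lemma sq_mul_sq_sech_le (x : ℝ) : x ^ 2 * sech x ^ 2 ≤ 4 * (1 + x ^ 2)⁻¹ := by
  have hc := Real.cosh_pos x
  have h := pow_le_pow_left₀ (by positivity) (one_add_sq_div_two_le_cosh x) 2
  rw [sech, div_pow, one_pow, mul_one_div, ← div_eq_mul_inv,
    div_le_div_iff₀ (by positivity) (by positivity)]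
  nlinarith [sq_nonneg x, sq_nonneg (x ^ 2)]

lemma sq_sech_le (x : ℝ) : sech x ^ 2 ≤ (1 + x ^ 2)⁻¹ := by
  rw [← one_div, le_div_iff₀ (by positivity), mul_comm]
  exact one_add_sq_mul_sq_sech_le x

lemma integrable_sq_sech : Integrable fun x => sech x ^ 2 :=
  integrable_inv_one_add_sq.mono' (by fun_prop) <| .of_forall fun x => by
    rw [Real.norm_of_nonneg (by positivity)]
    exact sq_sech_le x

lemma integrable_sq_mul_sq_sech : Integrable fun x => x ^ 2 * sech x ^ 2 :=
  (integrable_inv_one_add_sq.const_mul 4).mono' (by fun_prop) <| .of_forall fun x => by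
    rw [Real.norm_of_nonneg (by positivity)]
    exact sq_mul_sq_sech_le x

lemma sech_pow_four_le (x : ℝ) : sech x ^ 4 ≤ sech x ^ 2 :=
  pow_le_pow_of_le_one (sech_pos x).le (sech_le_one x) (by norm_num)

lemma integrable_sech_pow_four : Integrable fun x => sech x ^ 4 :=
  integrable_sq_sech.mono' (by fun_prop) <| .of_forall fun x => by
    rw [Real.norm_of_nonneg (by have := sech_pos x; positivity)]
    exact sech_pow_four_le x

lemma integrable_sq_mul_sech_pow_four : Integrable fun x => x ^ 2 * sech x ^ 4 :=
  integrable_sq_mul_sq_sech.mono' (by fun_prop) <| .of_forall fun x => by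
    rw [Real.norm_of_nonneg (by have := sech_pos x; positivity)]
    exact mul_le_mul_of_nonneg_left (sech_pow_four_le x) (sq_nonneg x)

lemma integrable_mul_sech_pow_four : Integrable fun x => x * sech x ^ 4 :=
  (integrable_sech_pow_four.add integrable_sq_mul_sech_pow_four).mono' (by fun_prop) <|
    .of_forall fun x => by
      have := sech_pos x
      rw [norm_mul, Real.norm_of_nonneg (by positivity : 0 ≤ sech x ^ 4), Real.norm_eq_abs]
      have h : |x| ≤ 1 + x ^ 2 := by nlinarith [sq_abs x, sq_nonneg (|x| - 1), abs_nonneg x]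
      calc |x| * sech x ^ 4 ≤ (1 + x ^ 2) * sech x ^ 4 := by gcongr
        _ = _ := by simp only [Pi.add_apply]; ring

lemma hasDerivAt_tanh (x : ℝ) : HasDerivAt Real.tanh (sech x ^ 2) x := by
  have h := (Real.hasDerivAt_sinh x).div (Real.hasDerivAt_cosh x) (Real.cosh_pos x).ne'
  refine (h.congr_deriv ?_).congr_of_eventuallyEq (.of_forall fun y => Real.tanh_eq_sinh_div_cosh y)
  rw [sech, div_pow, one_pow]
  congr 1
  linarith [Real.cosh_sq x]

lemma hasDerivAt_sech (x : ℝ) : HasDerivAt sech (-(sech x * Real.tanh x)) x := by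
  have h := (hasDerivAt_const x (1 : ℝ)).div (Real.hasDerivAt_cosh x) (Real.cosh_pos x).ne'
  refine h.congr_deriv ?_
  rw [sech, Real.tanh_eq_sinh_div_cosh]
  have := (Real.cosh_pos x).ne'
  field_simp
  ring

lemma sq_tanh (x : ℝ) : Real.tanh x ^ 2 = 1 - sech x ^ 2 := by
  rw [sech, Real.tanh_eq_sinh_div_cosh]
  have := (Real.cosh_pos x).ne'
  field_simp
  linarith [Real.cosh_sq x]

lemma tendsto_sq_mul_sq_sech :
    Tendsto (fun x => x ^ 2 * sech x ^ 2) atTop (nhds 0) := by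
  have h : Tendsto (fun x : ℝ => 4 * (1 + x ^ 2)⁻¹) atTop (nhds (4 * 0)) :=
    (tendsto_inv_atTop_zero.comp
      (tendsto_atTop_add_const_left _ 1 (tendsto_pow_atTop two_ne_zero))).const_mul 4
  rw [mul_zero] at h
  exact squeeze_zero (fun x => by positivity) sq_mul_sq_sech_le h

lemma tendsto_mul_sq_sech : Tendsto (fun x => x * sech x ^ 2) atTop (nhds 0) := by
  refine squeeze_zero' ?_ ?_ tendsto_sq_mul_sq_sech
  · filter_upwards [eventually_ge_atTop 0] with x hx
    positivity
  · filter_upwards [eventually_ge_atTop 1] with x hx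
    gcongr
    nlinarith

lemma tendsto_sq_sech : Tendsto (fun x => sech x ^ 2) atTop (nhds 0) := by
  refine squeeze_zero' (.of_forall fun x => by positivity) ?_ tendsto_mul_sq_sech
  filter_upwards [eventually_ge_atTop 1] with x hx
  exact le_mul_of_one_le_left (by positivity) hx

lemma tendsto_tanh_atTop : Tendsto Real.tanh atTop (nhds 1) := by
  have h : Tendsto (fun x => √(1 - sech x ^ 2)) atTop (nhds 1) := by
    simpa using (tendsto_sq_sech.const_sub 1).sqrt
  refine h.congr' ?_
  filter_upwards [eventually_ge_atTop 0] with x hx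
  rw [← sq_tanh, Real.sqrt_sq]
  rw [Real.tanh_eq_sinh_div_cosh]
  exact div_nonneg (Real.sinh_nonneg_iff.2 hx) (Real.cosh_pos x).le

lemma integral_sech_pow_four : ∫ x, sech x ^ 4 = 4 / 3 := by
  have h : ∫ x in Set.Ioi (0 : ℝ), sech x ^ 4 = (1 - 1 ^ 3 / 3) - 0 := by
    have := integral_Ioi_of_hasDerivAt_of_tendsto' (a := 0)
      (f := fun x => Real.tanh x - Real.tanh x ^ 3 / 3) (f' := fun x => sech x ^ 4)
      (fun x _ => ?_) integrable_sech_pow_four.integrableOn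
      (tendsto_tanh_atTop.sub ((tendsto_tanh_atTop.pow 3).div_const 3))
    · simpa using this
    · refine ((hasDerivAt_tanh x).sub (((hasDerivAt_tanh x).pow 3).div_const 3)).congr_deriv ?_
      have := sq_tanh x
      norm_num
      linear_combination -sech x ^ 2 * this
  have h' := integral_comp_abs (f := fun x => sech x ^ 4)
  simp only [sech_abs] at h'
  rw [h', h]
  norm_num

lemma hasSum_neg_one_pow_div_sq :
    HasSum (fun n : ℕ => (-1 : ℝ) ^ n / (n : ℝ) ^ 2) (-Real.pi ^ 2 / 12) := by
  have h := hasSum_one_div_nat_pow_mul_cos one_ne_zero (x := 1 / 2) ⟨by norm_num, by norm_num⟩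
  have hb : (Polynomial.map (algebraMap ℚ ℝ) (Polynomial.bernoulli (2 * 1))).eval (1 / 2)
      = -1 / 12 := by
    simp [Polynomial.bernoulli_def, Finset.sum_range_succ, bernoulli_one, bernoulli_two]
    norm_num
  rw [hb] at h
  convert h using 1
  · funext n
    rw [show 2 * Real.pi * n * (1 / 2) = n * Real.pi by ring, Real.cos_nat_mul_pi]
    ring
  · norm_num
    ring

lemma integral_Ioi_sq_mul_exp {n : ℕ} (hn : n ≠ 0) :
    ∫ x in Set.Ioi (0 : ℝ), x ^ 2 * Real.exp (-(2 * n * x)) = 1 / (4 * (n : ℝ) ^ 3) := by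
  have hn' : (0 : ℝ) < n := by positivity
  have h := Real.integral_rpow_mul_exp_neg_mul_Ioi (a := 3) (r := 2 * n) (by norm_num)
    (by positivity)
  have hG : Real.Gamma 3 = 2 := by simp
  rw [hG, show (3 : ℝ) - 1 = (2 : ℕ) by norm_num, show (3 : ℝ) = (3 : ℕ) by norm_num] at h
  simp only [Real.rpow_natCast] at h
  rw [h]
  field_simp
  norm_num

lemma integrableOn_Ioi_sq_mul_exp {n : ℕ} (hn : n ≠ 0) :
    IntegrableOn (fun x : ℝ => x ^ 2 * Real.exp (-(2 * n * x))) (Set.Ioi 0) := by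
  refine Integrable.of_integral_ne_zero ?_
  rw [integral_Ioi_sq_mul_exp hn]
  positivity

lemma hasSum_sq_mul_sq_sech {x : ℝ} (hx : 0 < x) :
    HasSum (fun n : ℕ => -4 * (-1) ^ n * n * (x ^ 2 * Real.exp (-(2 * n * x))))
      (x ^ 2 * sech x ^ 2) := by
  have hq : ‖-Real.exp (-(2 * x))‖ < 1 := by
    rw [norm_neg, Real.norm_of_nonneg (Real.exp_pos _).le, Real.exp_lt_one_iff]
    linarith
  convert! (hasSum_coe_mul_geometric_of_norm_lt_one hq).mul_left (-4 * x ^ 2) using 1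
  · funext n
    rw [neg_pow (Real.exp _), ← Real.exp_nat_mul]
    ring_nf
  · rw [sech, Real.cosh_eq, Real.exp_neg, show -(2 * x) = -x + -x by ring, Real.exp_add,
      Real.exp_neg, sub_neg_eq_add]
    have := Real.exp_pos x
    field_simp
    ring

lemma integral_Ioi_sq_mul_sq_sech :
    ∫ x in Set.Ioi (0 : ℝ), x ^ 2 * sech x ^ 2 = Real.pi ^ 2 / 12 := by
  have key := hasSum_integral_of_summable_integral_norm (μ := volume.restrict (Set.Ioi (0 : ℝ)))
    (F := fun (n : ℕ) (x : ℝ) => -4 * (-1) ^ n * n * (x ^ 2 * Real.exp (-(2 * n * x)))) ?_ ?_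
  · have hs : ∫ x in Set.Ioi (0 : ℝ), x ^ 2 * sech x ^ 2 = ∫ x in Set.Ioi (0 : ℝ),
        ∑' n : ℕ, -4 * (-1) ^ n * n * (x ^ 2 * Real.exp (-(2 * n * x))) :=
      setIntegral_congr_fun measurableSet_Ioi fun x hx => (hasSum_sq_mul_sq_sech hx).tsum_eq.symm
    rw [hs]
    refine key.unique ?_
    convert hasSum_neg_one_pow_div_sq.neg using 1
    · funext n
      rw [integral_const_mul]
      rcases eq_or_ne n 0 with rfl | hn
      · simp
      · rw [integral_Ioi_sq_mul_exp hn]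
        field_simp
    · ring
  · intro n
    rcases eq_or_ne n 0 with rfl | hn
    · simp
    · exact (integrableOn_Ioi_sq_mul_exp hn).const_mul _
  · refine (Real.summable_one_div_nat_pow.2 one_lt_two).congr fun n => ?_
    simp only [norm_mul, norm_pow, norm_neg, norm_one, one_pow, mul_one, integral_const_mul,
      Real.norm_eq_abs, Real.abs_exp, sq_abs]
    rcases eq_or_ne n 0 with rfl | hn
    · simp
    · rw [integral_Ioi_sq_mul_exp hn]
      norm_num
      field_simp

lemma integral_sq_mul_sech_pow_four :
    ∫ x, x ^ 2 * sech x ^ 4 = (Real.pi ^ 2 - 6) / 9 := by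
  have h : ∫ x in Set.Ioi (0 : ℝ), (x ^ 2 * sech x ^ 4 - 2 / 3 * (x ^ 2 * sech x ^ 2))
      = -1 / 3 := by
    have := integral_Ioi_of_hasDerivAt_of_tendsto' (a := 0)
      (f := fun x => (x ^ 2 * sech x ^ 2 * Real.tanh x + x * sech x ^ 2 - Real.tanh x) / 3)
      (f' := fun x => x ^ 2 * sech x ^ 4 - 2 / 3 * (x ^ 2 * sech x ^ 2))
      (fun x _ => ?_)
      (integrable_sq_mul_sech_pow_four.sub (integrable_sq_mul_sq_sech.const_mul _)).integrableOn
      (((tendsto_sq_mul_sq_sech.mul tendsto_tanh_atTop).add tendsto_mul_sq_sech).sub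
        tendsto_tanh_atTop |>.div_const 3)
    · simpa using this
    · have ht := hasDerivAt_tanh x
      have hs := (hasDerivAt_sech x).pow 2
      have hx := hasDerivAt_id x
      refine ((((((hx.pow 2).mul hs).mul ht).add (hx.mul hs)).sub ht).div_const 3).congr_deriv ?_
      have := sq_tanh x
      simp only [id, Pi.pow_apply, Pi.mul_apply]
      norm_num
      linear_combination (-2 / 3 * x ^ 2 * sech x ^ 2) * this
  rw [integral_sub integrable_sq_mul_sech_pow_four.integrableOn
    (integrable_sq_mul_sq_sech.const_mul _).integrableOn, integral_const_mul,
    integral_Ioi_sq_mul_sq_sech] at h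
  have h' := integral_comp_abs (f := fun x => x ^ 2 * sech x ^ 4)
  simp only [sech_abs, sq_abs] at h'
  rw [h']
  linarith

lemma integral_mul_sech_pow_four : ∫ x, x * sech x ^ 4 = 0 := by
  have h := integral_neg_eq_self (fun x => x * sech x ^ 4) volume
  simp only [sech_neg, neg_mul, integral_neg] at h
  linarith

/-- The graph of a function with monotone derivative lies above its tangent lines. -/
lemma tangent_le_of_monotone_deriv {f f' : ℝ → ℝ} (hf : ∀ x, HasDerivAt f (f' x) x)
    (hf' : Monotone f') (a y : ℝ) : f a + f' a * (y - a) ≤ f y := by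
  have hc : Continuous f := continuous_iff_continuousAt.2 fun x => (hf x).continuousAt
  rcases lt_trichotomy a y with h | rfl | h
  · obtain ⟨c, hc, he⟩ := exists_hasDerivAt_eq_slope f f' h hc.continuousOn fun x _ => hf x
    have := hf' hc.1.le
    rw [he, le_div_iff₀ (sub_pos.2 h)] at this
    linarith
  · simp
  · obtain ⟨c, hc, he⟩ := exists_hasDerivAt_eq_slope f f' h hc.continuousOn fun x _ => hf x
    have := hf' hc.2.le
    rw [he, div_le_iff₀ (sub_pos.2 h)] at this
    linarith

lemma hasDerivAt_exp_neg_sq_div_two (x : ℝ) :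
    HasDerivAt (fun x : ℝ => Real.exp (-x ^ 2 / 2)) (-x * Real.exp (-x ^ 2 / 2)) x := by
  have h := (((hasDerivAt_id x).pow 2).neg.div_const 2).exp
  refine h.congr_deriv ?_
  simp
  ring

lemma hasDerivAt_neg_mul_exp_neg_sq_div_two (x : ℝ) :
    HasDerivAt (fun x : ℝ => -x * Real.exp (-x ^ 2 / 2))
      ((x ^ 2 - 1) * Real.exp (-x ^ 2 / 2)) x := by
  refine ((hasDerivAt_id x).neg.mul (hasDerivAt_exp_neg_sq_div_two x)).congr_deriv ?_
  simp
  ring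

lemma abs_sq_sub_one_mul_exp_le (x : ℝ) : |(x ^ 2 - 1) * Real.exp (-x ^ 2 / 2)| ≤ 1 := by
  have h := Real.quadratic_le_exp_of_nonneg (x := x ^ 2 / 2) (by positivity)
  rw [neg_div, Real.exp_neg, abs_mul, abs_of_pos (a := (Real.exp (x ^ 2 / 2))⁻¹) (by positivity),
    ← div_eq_mul_inv, div_le_one (Real.exp_pos _), abs_le]
  constructor <;> nlinarith [sq_nonneg x, sq_nonneg (x ^ 2 / 2 - 1)]

lemma abs_exp_neg_sq_div_two_taylor (a t : ℝ) :
    |Real.exp (-(a + t) ^ 2 / 2) - Real.exp (-a ^ 2 / 2) + a * Real.exp (-a ^ 2 / 2) * t|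
      ≤ t ^ 2 / 2 := by
  have hq (x : ℝ) : HasDerivAt (fun x : ℝ => x ^ 2 / 2) x x := by
    simpa using (hasDerivAt_pow 2 x).div_const 2
  have h1 := tangent_le_of_monotone_deriv
    (fun x => (hq x).add (hasDerivAt_exp_neg_sq_div_two x))
    (monotone_of_hasDerivAt_nonneg
      (fun x => (hasDerivAt_id x).add (hasDerivAt_neg_mul_exp_neg_sq_div_two x))
      fun x => by
        have := (abs_le.1 (abs_sq_sub_one_mul_exp_le x)).1
        simp only [Pi.zero_apply]
        linarith) a (a + t)
  have h2 := tangent_le_of_monotone_deriv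
    (fun x => (hq x).sub (hasDerivAt_exp_neg_sq_div_two x))
    (monotone_of_hasDerivAt_nonneg
      (fun x => (hasDerivAt_id x).sub (hasDerivAt_neg_mul_exp_neg_sq_div_two x))
      fun x => by
        have := (abs_le.1 (abs_sq_sub_one_mul_exp_le x)).2
        simp only [Pi.zero_apply]
        linarith) a (a + t)
  simp only [Pi.add_apply, Pi.sub_apply] at h1 h2
  rw [abs_le]
  constructor <;> nlinarith

lemma mul_gexp_eq (f : ℝ → ℝ) {σ : ℝ} (hσ : 0 < σ) (h : ℝ) :
    σ * gexp f σ h = ∫ x, f x * stdGauss ((x - h) / σ) := by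
  have h1 := Measure.integral_comp_mul_left
    (fun x => f (h + x) * stdGauss (((h + x) - h) / σ)) σ
  have h2 := integral_add_left_eq_self (μ := volume) (fun x => f x * stdGauss ((x - h) / σ)) h
  rw [h2, abs_of_pos (inv_pos.2 hσ), smul_eq_mul] at h1
  rw [gexp, ← mul_inv_cancel_left₀ hσ.ne' (∫ x, f x * stdGauss ((x - h) / σ)), ← h1]
  congr 2
  funext z
  rw [add_sub_cancel_left, mul_div_cancel_left₀ z hσ.ne']

theorem stmt_8 (σ h : ℝ) (hσ : 0 < σ) :
    |σ * gexp (fun x => sech x ^ 4) σ h -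
        4 / (3 * Real.sqrt (2 * Real.pi)) * Real.exp (-h ^ 2 / (2 * σ ^ 2))|
      ≤ (Real.pi ^ 2 - 6) / (18 * Real.sqrt (2 * Real.pi)) / σ ^ 2 := by
  have hc : 0 < √(2 * Real.pi) := by positivity
  set c := √(2 * Real.pi) with hc_def
  set a := -h / σ with ha
  set E := Real.exp (-a ^ 2 / 2) with hE
  have hEh : Real.exp (-h ^ 2 / (2 * σ ^ 2)) = E := by
    rw [hE, ha]
    congr 1
    field_simp
  have hG : Integrable fun x => sech x ^ 4 * stdGauss ((x - h) / σ) := by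
    have hcont : Continuous stdGauss := by
      unfold stdGauss
      fun_prop
    refine (integrable_sech_pow_four.mul_const c⁻¹).mono' (by fun_prop) (.of_forall fun x => ?_)
    have := sech_pos x
    rw [norm_mul, Real.norm_of_nonneg (by positivity : 0 ≤ sech x ^ 4), stdGauss, ← hc_def,
      Real.norm_of_nonneg (by positivity), div_eq_mul_inv]
    gcongr
    refine mul_le_of_le_one_left (by positivity) (Real.exp_le_one_iff.2 ?_)
    nlinarith [sq_nonneg ((x - h) / σ)]
  have key : σ * gexp (fun x => sech x ^ 4) σ h - 4 / (3 * c) * E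
      = ∫ x, (sech x ^ 4 * stdGauss ((x - h) / σ) - E / c * sech x ^ 4
          + a * E / (c * σ) * (x * sech x ^ 4)) := by
    have hs := hG.sub (integrable_sech_pow_four.const_mul (E / c))
    simp only [Pi.sub_def] at hs
    rw [integral_add hs (integrable_mul_sech_pow_four.const_mul _), integral_sub hG
      (integrable_sech_pow_four.const_mul _), integral_const_mul, integral_const_mul,
      integral_sech_pow_four, integral_mul_sech_pow_four, mul_gexp_eq _ hσ]
    field_simp
    ring
  have hbound : (Real.pi ^ 2 - 6) / (18 * c) / σ ^ 2
      = ∫ x, 1 / (2 * c * σ ^ 2) * (x ^ 2 * sech x ^ 4) := by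
    rw [integral_const_mul, integral_sq_mul_sech_pow_four]
    field_simp
    ring
  rw [hEh, key, hbound, ← Real.norm_eq_abs]
  refine norm_integral_le_of_norm_le (integrable_sq_mul_sech_pow_four.const_mul _)
    (.of_forall fun x => ?_)
  have ht := abs_exp_neg_sq_div_two_taylor a (x / σ)
  rw [← hE] at ht
  have hx : (x - h) / σ = a + x / σ := by rw [ha]; ring
  have hs := sech_pos x
  calc ‖sech x ^ 4 * stdGauss ((x - h) / σ) - E / c * sech x ^ 4
          + a * E / (c * σ) * (x * sech x ^ 4)‖
      = ‖sech x ^ 4 / c * (Real.exp (-(a + x / σ) ^ 2 / 2) - E + a * E * (x / σ))‖ := by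
        rw [stdGauss, hx, ← hc_def]
        congr 1
        field_simp
    _ = sech x ^ 4 / c * |Real.exp (-(a + x / σ) ^ 2 / 2) - E + a * E * (x / σ)| := by
        rw [norm_mul, Real.norm_of_nonneg (by positivity), Real.norm_eq_abs]
    _ ≤ sech x ^ 4 / c * ((x / σ) ^ 2 / 2) := by gcongr
    _ = 1 / (2 * c * σ ^ 2) * (x ^ 2 * sech x ^ 4) := by field_simp
end

section
/- Let w₁ = (−1,1)/√2 and w₂ = (1,1)/√2, let v₁, v₂ be an orthonormal basis of ℝ², let λ₁ ≥ 0, ν ≥ 0, m₁ ∈ ℝ. Let f : ℝ² → ℝ be Lipschitz with Lipschitz constant Lip(f) and satisfy |f(x)| ≤ c₁ e^{−c₂‖x‖₂} for some c₁, c₂ > 0, and set c = max{√2/c₂, 2/c₂²}. Define Δ₁ = ∫_ℝ |E[f((m₁ + λ₁^{1/2}Z)v₁ + y v₂)] − E[f(ν^{1/2}Z w₁ + y w₂)]| dy and Δ₂ = ∫_ℝ |E[f((m₁ + λ₁^{1/2}Z)v₁ + y v₂)] − E[f(ν^{1/2}Z w₁ + y w₂)]| |y| dy, and the linear maps A = λ₁^{1/2}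 v₁⊗e₁ + v₂⊗e₂ and A_∞ = ν^{1/2} w₁⊗e₁ + w₂⊗e₂ (with {e₁,e₂} the standard basis, ‖·‖ the Frobenius norm). Then for every M ≥ 2 and for i = 1, 2: Δ_i ≤ Lip(f) · [ ‖A − A_∞‖ · M³ (1 + (4/M)(1 − e^{−M²/2})/√(2π)) + M² |m₁| ] + 4c₁c [ e^{−M/c}(M+1) + e^{−M²/2} ]. -/
open MeasureTheory Filter

/-- Euclidean inner product on `ℝ × ℝ`. -/
def dot (p q : ℝ × ℝ) : ℝ := p.1 * q.1 + p.2 * q.2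

/-- Euclidean norm on `ℝ × ℝ`. -/
noncomputable def enorm2 (p : ℝ × ℝ) : ℝ := Real.sqrt (p.1 ^ 2 + p.2 ^ 2)

/-- The transform `𝔊[f](x) = E[f((m₁ + λ₁^{1/2} Z) v₁ + x v₂)]`. -/
noncomputable def Gtrans (f : ℝ × ℝ → ℝ) (m1 lam1 : ℝ) (v1 v2 : ℝ × ℝ) (x : ℝ) : ℝ :=
  ∫ (z : ℝ), f ((m1 + Real.sqrt lam1 * z) • v1 + x • v2) * stdGauss z

theorem enorm2_eq_norm (p : ℝ × ℝ) : enorm2 p = ‖(⟨p.1, p.2⟩ : ℂ)‖ := by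
  rw [Complex.norm_def, Complex.normSq_mk, enorm2, sq, sq]

theorem enorm2_add_le (p q : ℝ × ℝ) : enorm2 (p + q) ≤ enorm2 p + enorm2 q := by
  simp only [enorm2_eq_norm]
  exact norm_add_le (⟨p.1, p.2⟩ : ℂ) ⟨q.1, q.2⟩

theorem enorm2_smul (r : ℝ) (p : ℝ × ℝ) : enorm2 (r • p) = |r| * enorm2 p := by
  simp only [enorm2, Prod.smul_fst, Prod.smul_snd, smul_eq_mul]
  rw [← Real.sqrt_sq_eq_abs, ← Real.sqrt_mul (sq_nonneg r)]
  congr 1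
  ring

theorem enorm2_nonneg (p : ℝ × ℝ) : 0 ≤ enorm2 p := Real.sqrt_nonneg _

/-- A function that is Lipschitz for the Euclidean norm on `ℝ × ℝ` is continuous. -/
theorem continuous_of_enorm2_lipschitz {f : ℝ × ℝ → ℝ} {L : ℝ}
    (hLip : ∀ x y, |f x - f y| ≤ L * enorm2 (x - y)) : Continuous f := by
  rw [continuous_iff_continuousAt]
  intro x
  rw [ContinuousAt, tendsto_iff_dist_tendsto_zero]
  refine squeeze_zero (fun _ => dist_nonneg) (fun y => hLip y x) ?_
  have h : Continuous fun y : ℝ × ℝ => L * enorm2 (y - x) := by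
    unfold enorm2
    fun_prop
  simpa [enorm2] using h.tendsto x

theorem stdGauss_eq_gaussianPDFReal : stdGauss = ProbabilityTheory.gaussianPDFReal 0 1 := by
  ext z
  simp [stdGauss, ProbabilityTheory.gaussianPDFReal, div_eq_inv_mul]

theorem stdGauss_nonneg (z : ℝ) : 0 ≤ stdGauss z := by
  unfold stdGauss
  positivity

theorem integrable_stdGauss : Integrable stdGauss := by
  rw [stdGauss_eq_gaussianPDFReal]
  exact ProbabilityTheory.integrable_gaussianPDFReal 0 1

theorem integral_stdGauss : ∫ z, stdGauss z = 1 := by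
  rw [stdGauss_eq_gaussianPDFReal]
  exact ProbabilityTheory.integral_gaussianPDFReal_eq_one 0 one_ne_zero

theorem integral_sq_mul_stdGauss : ∫ z, z ^ 2 * stdGauss z = 1 := by
  have h := ProbabilityTheory.variance_id_gaussianReal (μ := 0) (v := 1)
  rw [ProbabilityTheory.variance_of_integral_eq_zero (by fun_prop) (by simp),
    ProbabilityTheory.integral_gaussianReal_eq_integral_smul one_ne_zero,
    ← stdGauss_eq_gaussianPDFReal] at h
  simpa [mul_comm] using h

theorem integrable_sq_mul_stdGauss : Integrable fun z => z ^ 2 * stdGauss z := by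
  by_contra h
  have := integral_sq_mul_stdGauss
  rw [integral_undef h] at this
  exact zero_ne_one this

theorem integrable_comp_mul_stdGauss {f : ℝ × ℝ → ℝ} (hf : Continuous f) {C : ℝ}
    (hC : ∀ x, |f x| ≤ C) (m s y : ℝ) (v w : ℝ × ℝ) :
    Integrable fun z => f ((m + s * z) • v + y • w) * stdGauss z :=
  integrable_stdGauss.bdd_mul (by fun_prop) (ae_of_all _ fun _ => hC _)

theorem abs_le_enorm2_of_orthonormal {v w : ℝ × ℝ}
    (h : dot v v = 1 ∧ dot w w = 1 ∧ dot v w = 0) (s y : ℝ) :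
    |y| ≤ enorm2 (s • v + y • w) := by
  obtain ⟨h1, h2, h3⟩ := h
  simp only [dot] at h1 h2 h3
  refine Real.abs_le_sqrt ?_
  simp only [Prod.fst_add, Prod.snd_add, Prod.smul_fst, Prod.smul_snd, smul_eq_mul]
  have : (s * v.1 + y * w.1) ^ 2 + (s * v.2 + y * w.2) ^ 2 = s ^ 2 + y ^ 2 := by
    linear_combination s ^ 2 * h1 + y ^ 2 * h2 + 2 * s * y * h3
  rw [this]
  nlinarith [sq_nonneg s]

theorem abs_Gtrans_le {f : ℝ × ℝ → ℝ} {c₁ c₂ : ℝ} (hc₁ : 0 < c₁) (hc₂ : 0 < c₂)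
    (hdecay : ∀ x, |f x| ≤ c₁ * Real.exp (-c₂ * enorm2 x)) (m l : ℝ) {v w : ℝ × ℝ}
    (h : dot v v = 1 ∧ dot w w = 1 ∧ dot v w = 0) (y : ℝ) :
    |Gtrans f m l v w y| ≤ c₁ * Real.exp (-c₂ * |y|) := by
  have key := norm_integral_le_of_norm_le
    (f := fun z => f ((m + Real.sqrt l * z) • v + y • w) * stdGauss z)
    (integrable_stdGauss.const_mul (c₁ * Real.exp (-c₂ * |y|))) (ae_of_all _ fun z => by
      rw [Real.norm_eq_abs, abs_mul, abs_of_nonneg (stdGauss_nonneg z)]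
      refine mul_le_mul_of_nonneg_right ((hdecay _).trans ?_) (stdGauss_nonneg z)
      have := abs_le_enorm2_of_orthonormal h (m + Real.sqrt l * z) y
      refine mul_le_mul_of_nonneg_left (Real.exp_le_exp.2 ?_) hc₁.le
      nlinarith)
  rwa [integral_const_mul, integral_stdGauss, mul_one] at key

theorem abs_Gtrans_sub_le {f : ℝ × ℝ → ℝ} {L C : ℝ} (hL : 0 ≤ L)
    (hLip : ∀ x y, |f x - f y| ≤ L * enorm2 (x - y)) (hC : ∀ x, |f x| ≤ C)
    (m l n F : ℝ) {v₁ v₂ w₁ w₂ : ℝ × ℝ} (hv : enorm2 v₁ = 1)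
    (h₁ : enorm2 (Real.sqrt l • v₁ - Real.sqrt n • w₁) ≤ F) (h₂ : enorm2 (v₂ - w₂) ≤ F) (y : ℝ) :
    |Gtrans f m l v₁ v₂ y - Gtrans f 0 n w₁ w₂ y| ≤ L * (|m| + F * (1 + |y|)) := by
  have hf := continuous_of_enorm2_lipschitz hLip
  have hF : 0 ≤ F := (enorm2_nonneg _).trans h₂
  unfold Gtrans
  rw [← integral_sub (integrable_comp_mul_stdGauss hf hC _ _ _ _ _)
    (integrable_comp_mul_stdGauss hf hC _ _ _ _ _)]
  have key := norm_integral_le_of_norm_le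
    (f := fun z => f ((m + Real.sqrt l * z) • v₁ + y • v₂) * stdGauss z -
      f ((0 + Real.sqrt n * z) • w₁ + y • w₂) * stdGauss z)
    ((integrable_stdGauss.const_mul (L * (|m| + F * (1 / 2 + |y|)))).add
      (integrable_sq_mul_stdGauss.const_mul (L * F / 2))) (ae_of_all _ fun z => by
      rw [← sub_mul, Real.norm_eq_abs, abs_mul, abs_of_nonneg (stdGauss_nonneg z)]
      have e : (m + Real.sqrt l * z) • v₁ + y • v₂ - ((0 + Real.sqrt n * z) • w₁ + y • w₂) =
          m • v₁ + z • (Real.sqrt l • v₁ - Real.sqrt n • w₁) + y • (v₂ - w₂) := by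
        module
      have hz : |z| ≤ (1 + z ^ 2) / 2 := by
        rw [← sq_abs]
        nlinarith [sq_nonneg (|z| - 1)]
      have hn : enorm2 ((m + Real.sqrt l * z) • v₁ + y • v₂ -
          ((0 + Real.sqrt n * z) • w₁ + y • w₂)) ≤ |m| + F * ((1 + z ^ 2) / 2 + |y|) := by
        rw [e]
        calc _ ≤ enorm2 (m • v₁) + enorm2 (z • (Real.sqrt l • v₁ - Real.sqrt n • w₁)) +
                enorm2 (y • (v₂ - w₂)) :=
              (enorm2_add_le _ _).trans (add_le_add_left (enorm2_add_le _ _) _)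
          _ ≤ |m| + (1 + z ^ 2) / 2 * F + |y| * F := by
              rw [enorm2_smul, enorm2_smul, enorm2_smul, hv, mul_one]
              gcongr
              exact enorm2_nonneg _
          _ = _ := by ring
      calc _ ≤ L * (|m| + F * ((1 + z ^ 2) / 2 + |y|)) * stdGauss z :=
            mul_le_mul_of_nonneg_right ((hLip _ _).trans (mul_le_mul_of_nonneg_left hn hL))
              (stdGauss_nonneg z)
        _ = _ := by
            simp only [Pi.add_apply]
            ring)
  refine key.trans (le_of_eq ?_)
  simp only [Pi.add_apply]
  rw [integral_add (integrable_stdGauss.const_mul _) (integrable_sq_mul_stdGauss.const_mul _),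
    integral_const_mul, integral_const_mul, integral_stdGauss, integral_sq_mul_stdGauss]
  ring

theorem integrable_comp_abs_of_integrableOn_Ioi {f : ℝ → ℝ} (hf : IntegrableOn f (Set.Ioi 0)) :
    Integrable fun x => f |x| := by
  have hpos : IntegrableOn (fun x => f |x|) (Set.Ioi 0) :=
    hf.congr_fun (fun x (hx : 0 < x) => by rw [abs_of_pos hx]) measurableSet_Ioi
  have hneg : IntegrableOn (fun x => f |x|) (Set.Iic 0) := by
    have emb : MeasurableEmbedding fun x : ℝ => -x := (Homeomorph.neg ℝ).measurableEmbedding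
    rw [← Measure.map_neg_eq_self (volume : Measure ℝ), emb.integrableOn_map_iff]
    simpa [Function.comp_def, integrableOn_Ici_iff_integrableOn_Ioi] using hpos
  rw [← integrableOn_univ, ← Set.Iic_union_Ioi (a := (0 : ℝ))]
  exact hneg.union hpos

/-- Integral bound for a function dominated by `a |y|` for `|y| ≤ M` and by `b |y|` beyond, in terms
of antiderivatives `A` of `a` and `B` of `b`. -/
theorem integral_le_of_le_comp_abs {g a b A B : ℝ → ℝ} {M : ℝ} (hM : 0 ≤ M) (hg : ∀ y, 0 ≤ g y)
    (hA : ∀ t, HasDerivAt A (a t) t) (ha : Continuous a)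
    (hB : ∀ t, HasDerivAt B (b t) t) (hb : ∀ t, M < t → 0 ≤ b t) (hB0 : Tendsto B atTop (nhds 0))
    (hga : ∀ y, |y| ≤ M → g y ≤ a |y|) (hgb : ∀ y, M < |y| → g y ≤ b |y|) :
    ∫ y, g y ≤ 2 * (A M - A 0 - B M) := by
  set h : ℝ → ℝ := fun t => if t ≤ M then a t else b t with hh
  have h1 : Set.EqOn h a (Set.Ioc 0 M) := fun t ht => if_pos ht.2
  have h2 : Set.EqOn h b (Set.Ioi M) := fun t ht => if_neg (not_le.2 ht)
  have i1 : IntegrableOn h (Set.Ioc 0 M) :=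
    (ha.integrableOn_Ioc).congr_fun h1.symm measurableSet_Ioc
  have i2b : IntegrableOn b (Set.Ioi M) :=
    integrableOn_Ioi_deriv_of_nonneg' (fun t _ => hB t) hb hB0
  have i2 : IntegrableOn h (Set.Ioi M) := i2b.congr_fun h2.symm measurableSet_Ioi
  have i : IntegrableOn h (Set.Ioi 0) := by
    rw [← Set.Ioc_union_Ioi_eq_Ioi hM]
    exact i1.union i2
  have hint : Integrable fun y => h |y| := by
    exact integrable_comp_abs_of_integrableOn_Ioi i
  calc ∫ y, g y ≤ ∫ y, h |y| := by
        refine integral_mono_of_nonneg (ae_of_all _ hg) hint (ae_of_all _ fun y => ?_)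
        by_cases hy : |y| ≤ M
        · simpa [hh, hy] using hga y hy
        · simpa [hh, hy] using hgb y (not_le.1 hy)
    _ = 2 * (A M - A 0 - B M) := by
        rw [integral_comp_abs, ← Set.Ioc_union_Ioi_eq_Ioi hM,
          setIntegral_union Set.Ioc_disjoint_Ioi_same measurableSet_Ioi i1 i2,
          setIntegral_congr_fun measurableSet_Ioc h1, setIntegral_congr_fun measurableSet_Ioi h2,
          ← intervalIntegral.integral_of_le hM,
          intervalIntegral.integral_eq_sub_of_hasDerivAt (fun t _ => hA t)
            (ha.intervalIntegrable _ _),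
          integral_Ioi_of_hasDerivAt_of_tendsto' (fun t _ => hB t) i2b hB0]
        ring

theorem hasDerivAt_exp_neg_mul (k t : ℝ) :
    HasDerivAt (fun t => Real.exp (-k * t)) (Real.exp (-k * t) * -k) t := by
  simpa using ((hasDerivAt_id t).const_mul (-k)).exp

theorem tendsto_exp_neg_mul {k : ℝ} (hk : 0 < k) :
    Tendsto (fun t => Real.exp (-k * t)) atTop (nhds 0) :=
  Real.tendsto_exp_atBot.comp (tendsto_id.const_mul_atTop_of_neg (neg_lt_zero.2 hk))

theorem integral_le_of_affine_of_exp {g : ℝ → ℝ} {L m F C k M : ℝ} (hM : 0 ≤ M) (hC : 0 ≤ C)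
    (hk : 0 < k) (hg : ∀ y, 0 ≤ g y) (hin : ∀ y, g y ≤ L * (m + F * (1 + |y|)))
    (hout : ∀ y, g y ≤ C * Real.exp (-k * |y|)) :
    ∫ y, g y ≤ L * (m * (2 * M) + F * (M ^ 2 + 2 * M)) + 2 * C * (1 / k * Real.exp (-k * M)) := by
  refine (integral_le_of_le_comp_abs hM hg
    (a := fun t => L * (m + F * (1 + t))) (A := fun t => L * (m * t + F * (t + t ^ 2 / 2)))
    (b := fun t => C * Real.exp (-k * t)) (B := fun t => -(C / k) * Real.exp (-k * t))
    (fun t => ?_) (by fun_prop) (fun t => ?_) (fun t _ => by positivity)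
    (by simpa only [mul_zero] using (tendsto_exp_neg_mul hk).const_mul (-(C / k)))
    (fun y _ => hin y) (fun y _ => hout y)).trans (le_of_eq ?_)
  · refine ((((hasDerivAt_id' t).const_mul m).add (((hasDerivAt_id' t).add
      (((hasDerivAt_id' t).pow 2).div_const 2)).const_mul F)).const_mul L).congr_deriv ?_
    simp
  · refine ((hasDerivAt_exp_neg_mul k t).const_mul _).congr_deriv ?_
    field_simp
  · ring

theorem integral_mul_abs_le_of_affine_of_exp {g : ℝ → ℝ} {L m F C k M : ℝ} (hM : 0 ≤ M)
    (hC : 0 ≤ C) (hk : 0 < k) (hg : ∀ y, 0 ≤ g y) (hin : ∀ y, g y ≤ L * (m + F * (1 + |y|)))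
    (hout : ∀ y, g y ≤ C * Real.exp (-k * |y|)) :
    ∫ y, g y * |y| ≤ L * (m * M ^ 2 + F * (M ^ 2 + 2 * M ^ 3 / 3)) +
      2 * C * ((M / k + 1 / k ^ 2) * Real.exp (-k * M)) := by
  have hlim : Tendsto (fun t => t * Real.exp (-k * t)) atTop (nhds 0) := by
    simpa using tendsto_rpow_mul_exp_neg_mul_atTop_nhds_zero 1 k hk
  refine (integral_le_of_le_comp_abs hM (fun y => mul_nonneg (hg y) (abs_nonneg y))
    (a := fun t => L * (m + F * (1 + t)) * t)
    (A := fun t => L * (m * (t ^ 2 / 2) + F * (t ^ 2 / 2 + t ^ 3 / 3)))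
    (b := fun t => C * Real.exp (-k * t) * t)
    (B := fun t => -(C / k) * (t * Real.exp (-k * t)) - C / k ^ 2 * Real.exp (-k * t))
    (fun t => ?_) (by fun_prop) (fun t => ?_) (fun t ht => ?_)
    (by simpa only [mul_zero, sub_zero] using
      (hlim.const_mul (-(C / k))).sub ((tendsto_exp_neg_mul hk).const_mul (C / k ^ 2)))
    (fun y _ => mul_le_mul_of_nonneg_right (hin y) (abs_nonneg y))
    (fun y _ => mul_le_mul_of_nonneg_right (hout y) (abs_nonneg y))).trans (le_of_eq ?_)
  · refine (((((hasDerivAt_id' t).pow 2).div_const 2).const_mul m).add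
      (((((hasDerivAt_id' t).pow 2).div_const 2).add
      (((hasDerivAt_id' t).pow 3).div_const 3)).const_mul F)).const_mul L |>.congr_deriv ?_
    simp
    ring
  · refine ((((hasDerivAt_id' t).mul (hasDerivAt_exp_neg_mul k t)).const_mul _).sub
      ((hasDerivAt_exp_neg_mul k t).const_mul _)).congr_deriv ?_
    field_simp
    ring
  · have : 0 < t := hM.trans_lt ht
    positivity
  · ring

theorem one_div_twelve_le_one_sub_exp_div_sqrt {M : ℝ} (hM : 2 ≤ M) :
    1 / 12 ≤ (1 - Real.exp (-M ^ 2 / 2)) / Real.sqrt (2 * Real.pi) := by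
  have h1 : Real.exp (-M ^ 2 / 2) ≤ 1 / 2 := by
    have : Real.exp (-M ^ 2 / 2) ≤ Real.exp (-1) := Real.exp_le_exp.2 (by nlinarith)
    linarith [Real.exp_neg_one_lt_half]
  have h2 : Real.sqrt (2 * Real.pi) ≤ 3 := by
    rw [Real.sqrt_le_left (by norm_num)]
    linarith [Real.pi_lt_four]
  rw [le_div_iff₀ (by positivity)]
  linarith

theorem stmt_11 (f : ℝ × ℝ → ℝ) (Lf : ℝ)
    (hLip : ∀ x y, |f x - f y| ≤ Lf * enorm2 (x - y))
    (c₁ c₂ : ℝ) (hc₁ : 0 < c₁) (hc₂ : 0 < c₂)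
    (hdecay : ∀ x, |f x| ≤ c₁ * Real.exp (-c₂ * enorm2 x))
    (lam1 ν m1 : ℝ) (hlam1 : 0 ≤ lam1) (hν : 0 ≤ ν)
    (v1 v2 : ℝ × ℝ) (hv : dot v1 v1 = 1 ∧ dot v2 v2 = 1 ∧ dot v1 v2 = 0)
    (M : ℝ) (hM : 2 ≤ M) :
    let w1 : ℝ × ℝ := (-1 / Real.sqrt 2, 1 / Real.sqrt 2)
    let w2 : ℝ × ℝ := (1 / Real.sqrt 2, 1 / Real.sqrt 2)
    let c := max (Real.sqrt 2 / c₂) (2 / c₂ ^ 2)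
    -- Frobenius norm of `A - A_∞`, where `A = λ₁^{1/2} v₁⊗e₁ + v₂⊗e₂` and
    -- `A_∞ = ν^{1/2} w₁⊗e₁ + w₂⊗e₂`; its columns are `√λ₁ v₁ - √ν w₁` and `v₂ - w₂`.
    let frobAAinf := Real.sqrt
      (enorm2 (Real.sqrt lam1 • v1 - Real.sqrt ν • w1) ^ 2 + enorm2 (v2 - w2) ^ 2)
    let bound := Lf * (frobAAinf *
          (M ^ 3 * (1 + 4 / M * ((1 - Real.exp (-M ^ 2 / 2)) / Real.sqrt (2 * Real.pi)))) +
        M ^ 2 * |m1|) +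
      4 * c₁ * c * (Real.exp (-M / c) * (M + 1) + Real.exp (-M ^ 2 / 2))
    (∫ y, |Gtrans f m1 lam1 v1 v2 y - Gtrans f 0 ν w1 w2 y|) ≤ bound ∧
      (∫ y, |Gtrans f m1 lam1 v1 v2 y - Gtrans f 0 ν w1 w2 y| * |y|) ≤ bound := by
  intro w1 w2 c F bound
  have hs2 : Real.sqrt 2 ^ 2 = 2 := Real.sq_sqrt zero_le_two
  have hs2' : 0 < Real.sqrt 2 := by positivity
  have hw : dot w1 w1 = 1 ∧ dot w2 w2 = 1 ∧ dot w1 w2 = 0 := by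
    refine ⟨?_, ?_, ?_⟩ <;> simp only [dot, w1, w2] <;> field_simp <;> linarith
  have hL : 0 ≤ Lf := by
    have := (abs_nonneg _).trans (hLip (1, 0) 0)
    simpa [enorm2] using this
  have hC : ∀ x, |f x| ≤ c₁ := fun x => by
    refine (hdecay x).trans (mul_le_of_le_one_right hc₁.le (Real.exp_le_one_iff.2 ?_))
    nlinarith [enorm2_nonneg x]
  have hv1 : enorm2 v1 = 1 := by
    have := hv.1
    rw [dot, ← sq, ← sq] at this
    rw [enorm2, this, Real.sqrt_one]
  have hF1 : enorm2 (Real.sqrt lam1 • v1 - Real.sqrt ν • w1) ≤ F :=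
    Real.le_sqrt_of_sq_le (le_add_of_nonneg_right (sq_nonneg _))
  have hF2 : enorm2 (v2 - w2) ≤ F :=
    Real.le_sqrt_of_sq_le (le_add_of_nonneg_left (sq_nonneg _))
  have hF : 0 ≤ F := Real.sqrt_nonneg _
  have hin : ∀ y, |Gtrans f m1 lam1 v1 v2 y - Gtrans f 0 ν w1 w2 y| ≤
      Lf * (|m1| + F * (1 + |y|)) :=
    abs_Gtrans_sub_le hL hLip hC m1 lam1 ν F hv1 hF1 hF2
  have hout : ∀ y, |Gtrans f m1 lam1 v1 v2 y - Gtrans f 0 ν w1 w2 y| ≤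
      2 * c₁ * Real.exp (-c₂ * |y|) := fun y => by
    refine (abs_sub _ _).trans ?_
    linarith [abs_Gtrans_le hc₁ hc₂ hdecay m1 lam1 hv y, abs_Gtrans_le hc₁ hc₂ hdecay 0 ν hw y]
  have hM0 : 0 ≤ M := by linarith
  have hc1 : 1 / c₂ ≤ c := by
    refine le_trans ?_ (le_max_left _ _)
    gcongr
    exact Real.one_le_sqrt.2 one_le_two
  have hc2 : 1 / c₂ ^ 2 ≤ c := by
    refine le_trans ?_ (le_max_right _ _)
    gcongr
    exact one_le_two
  have hcpos : 0 < c := lt_of_lt_of_le (by positivity) hc1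
  have hexpM : Real.exp (-c₂ * M) ≤ Real.exp (-M / c) := by
    refine Real.exp_le_exp.2 ?_
    have : 1 / c ≤ c₂ := by
      rw [div_le_iff₀ hc₂] at hc1
      rw [div_le_iff₀ hcpos]
      linarith
    calc -c₂ * M ≤ -(1 / c) * M := by nlinarith
      _ = -M / c := by ring
  have hG : 0 ≤ 4 * c₁ * c * Real.exp (-M ^ 2 / 2) := by positivity
  have htail : (M / c₂ + 1 / c₂ ^ 2) * Real.exp (-c₂ * M) ≤ c * (M + 1) * Real.exp (-M / c) := by
    refine mul_le_mul ?_ hexpM (Real.exp_pos _).le (by positivity)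
    calc M / c₂ + 1 / c₂ ^ 2 = M * (1 / c₂) + 1 / c₂ ^ 2 := by ring
      _ ≤ M * c + c := by gcongr
      _ = _ := by ring
  have htail0 : 1 / c₂ * Real.exp (-c₂ * M) ≤ c * (M + 1) * Real.exp (-M / c) := by
    refine mul_le_mul ?_ hexpM (Real.exp_pos _).le (by positivity)
    nlinarith
  have hK := one_div_twelve_le_one_sub_exp_div_sqrt hM
  set K := (1 - Real.exp (-M ^ 2 / 2)) / Real.sqrt (2 * Real.pi) with hKdef
  have hMK : M ^ 3 * (1 + 4 / M * K) = M ^ 3 + 4 * M ^ 2 * K := by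
    have : M ≠ 0 := by linarith
    field_simp
  have hm := abs_nonneg m1
  have hB : bound = Lf * (F * (M ^ 3 + 4 * M ^ 2 * K) + M ^ 2 * |m1|) +
      4 * c₁ * c * (Real.exp (-M / c) * (M + 1) + Real.exp (-M ^ 2 / 2)) := by
    rw [← hMK]
  rw [hB]
  constructor
  · refine (integral_le_of_affine_of_exp hM0 (by positivity) hc₂ (fun _ => abs_nonneg _)
      hin hout).trans (add_le_add (mul_le_mul_of_nonneg_left ?_ hL) ?_)
    · have hMM : M ^ 2 + 2 * M ≤ M ^ 3 + 4 * M ^ 2 * K := by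
        nlinarith [mul_nonneg (sq_nonneg M) (show (0 : ℝ) ≤ K by linarith),
          mul_nonneg hM0 (sub_nonneg.2 hM), mul_nonneg (sq_nonneg M) (sub_nonneg.2 hM)]
      have := mul_le_mul_of_nonneg_left hMM hF
      linarith [mul_nonneg hm (mul_nonneg hM0 (sub_nonneg.2 hM))]
    · linarith [mul_le_mul_of_nonneg_left htail0 (show (0 : ℝ) ≤ 4 * c₁ by positivity)]
  · refine (integral_mul_abs_le_of_affine_of_exp hM0 (by positivity) hc₂ (fun _ => abs_nonneg _)
      hin hout).trans (add_le_add (mul_le_mul_of_nonneg_left ?_ hL) ?_)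
    · have hMM : M ^ 2 + 2 * M ^ 3 / 3 ≤ M ^ 3 + 4 * M ^ 2 * K := by
        nlinarith [mul_nonneg (sq_nonneg M) (sub_nonneg.2 hK),
          mul_nonneg (sq_nonneg M) (sub_nonneg.2 hM)]
      linarith [mul_le_mul_of_nonneg_left hMM hF]
    · linarith [mul_le_mul_of_nonneg_left htail (show (0 : ℝ) ≤ 4 * c₁ by positivity)]
end
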